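/- If G is a finite supersolvable group, then MaxDim(G) = m(G). -/

import Mathlib

/-- A sequence of group elements is irredundant if no element lies in the
subgroup generated by the others. -/
def Irredundant {G : Type*} [Group G] {n : ℕ} (g : Fin n → G) : Prop :=
  ∀ i, g i ∉ Subgroup.closure (g '' {j | j ≠ i})

/-- A sequence of group elements generates the group. -/
def Generates {G : Type*} [Group G] {n : ℕ} (g : Fin n → G) : Prop :=
  Subgroup.closure (Set.range g) = ⊤

/-- A family of subgroups is in general position if removing any one member
strictly enlarges the intersection. -/
def InGeneralPosition {G : Type*} [Group G] {n : ℕ} (H : Fin n → Subgroup G) : Prop :=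
  ∀ i, (⨅ j, H j) < ⨅ j ∈ {j | j ≠ i}, H j

/-- `mG G` is the maximum length of an irredundant generating sequence of `G`. -/
noncomputable def mG (G : Type*) [Group G] : ℕ :=
  sSup {n | ∃ g : Fin n → G, Irredundant g ∧ Generates g}

/-- `iG G` is the maximum length of an irredundant sequence in `G`. -/
noncomputable def iG (G : Type*) [Group G] : ℕ :=
  sSup {n | ∃ g : Fin n → G, Irredundant g}

/-- `MaxDim G` is the maximum size of a family of maximal subgroups of `G`
in general position. -/
noncomputable def MaxDim (G : Type*) [Group G] : ℕ :=
  sSup {n | ∃ M : Fin n → Subgroup G, (∀ i, IsCoatom (M i)) ∧ InGeneralPosition M}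

/-- For subgroups `A B ≤ G` with `A` normal in `G`, the quotient `B / (A ∩ B)`
(that is, `B/A` when `A ≤ B`) is cyclic. -/
def CyclicQuot {G : Type*} [Group G] (A B : Subgroup G) (hA : A.Normal) : Prop := by
  letI : (A.subgroupOf B).Normal := hA.subgroupOf B
  exact IsCyclic (B ⧸ A.subgroupOf B)

/-- For subgroups `A ≤ B ≤ G` with `A` normal in `G`, the quotient `B/A`
is cyclic of prime order. -/
def PrimeCyclicQuot {G : Type*} [Group G] (A B : Subgroup G) (hA : A.Normal) : Prop := by
  letI : (A.subgroupOf B).Normal := hA.subgroupOf B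
  exact IsCyclic (B ⧸ A.subgroupOf B) ∧ (Nat.card (B ⧸ A.subgroupOf B)).Prime

/-- A group `G` is supersolvable if it has a chain
`1 = G₀ ≤ G₁ ≤ ⋯ ≤ Gₙ = G` of subgroups, each normal in `G`, with each
successive quotient `G_{i+1}/G_i` cyclic. -/
def Supersolvable (G : Type*) [Group G] : Prop :=
  ∃ (n : ℕ) (H : Fin (n + 1) → Subgroup G) (hnorm : ∀ i, (H i).Normal),
    H 0 = ⊥ ∧ H (Fin.last n) = ⊤ ∧
    (∀ i : Fin n, H i.castSucc ≤ H i.succ) ∧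
    ∀ i : Fin n, CyclicQuot (H i.castSucc) (H i.succ) (hnorm i.castSucc)

open Subgroup

section General

variable {G : Type*} [Group G]

/-- Some generating set of `G` contains at least `k` elements none of which can be removed from it
without losing the generating property. -/
def HasIndispensable (G : Type*) [Group G] (k : ℕ) : Prop :=
  ∃ S T : Set G, closure S = ⊤ ∧ T ⊆ S ∧ (∀ t ∈ T, closure (S \ {t}) ≠ ⊤) ∧ k ≤ T.ncard

theorem Irredundant.injective {n : ℕ} {g : Fin n → G} (hg : Irredundant g) :
    Function.Injective g := by
  intro i j hij
  by_contra hne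
  exact hg i (hij ▸ subset_closure ⟨j, fun h => hne h.symm, rfl⟩)

theorem bddAbove_irredundant_generating [Finite G] :
    BddAbove {n | ∃ g : Fin n → G, Irredundant g ∧ Generates g} := by
  refine ⟨Nat.card G, ?_⟩
  rintro n ⟨g, hg, -⟩
  simpa using Nat.card_le_card_of_injective g hg.injective

theorem HasIndispensable.le_mG [Finite G] {k : ℕ} (h : HasIndispensable G k) : k ≤ mG G := by
  obtain ⟨S, T, hS, hTS, hT, hk⟩ := h
  obtain ⟨U, -, ⟨⟨hTU, hUS, hU⟩, hmin⟩⟩ :=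
    (Set.toFinite {U : Set G | T ⊆ U ∧ U ⊆ S ∧ closure U = ⊤}).exists_le_minimal
      (a := S) ⟨hTS, subset_rfl, hS⟩
  have hirr : ∀ u ∈ U, closure (U \ {u}) ≠ ⊤ := by
    intro u hu htop
    by_cases huT : u ∈ T
    · exact hT u huT (top_le_iff.1 (htop ▸ closure_mono (Set.sdiff_subset_sdiff_left hUS)))
    · have := hmin (y := U \ {u})
        ⟨fun t ht => ⟨hTU ht, fun h => huT (h ▸ ht)⟩, Set.sdiff_subset.trans hUS, htop⟩
        Set.sdiff_subset
      exact (this hu).2 rfl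
  refine hk.trans ((Set.ncard_le_ncard hTU).trans (le_csSup bddAbove_irredundant_generating ?_))
  let e : Fin U.ncard ≃ U := (Finite.equivFinOfCardEq (Nat.card_coe_set_eq U)).symm
  have hrange : Set.range (fun i => (e i : G)) = U := by
    rw [← Function.comp_def Subtype.val e, e.surjective.range_comp, Subtype.range_coe]
  refine ⟨fun i => e i, fun i hi => hirr (e i) (e i).2 ?_, ?_⟩
  · have hsub : (fun i => (e i : G)) '' {j | j ≠ i} ⊆ U \ {(e i : G)} := by
      rintro _ ⟨j, hj, rfl⟩
      exact ⟨(e j).2, fun h => hj (e.injective (Subtype.ext h))⟩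
    rw [eq_top_iff, ← hU, closure_le]
    intro u hu
    by_cases h : u = e i
    · rw [h]
      exact Subgroup.closure_mono hsub hi
    · exact subset_closure ⟨hu, h⟩
  · rw [Generates, hrange, hU]

theorem inGeneralPosition_iff {n : ℕ} {H : Fin n → Subgroup G} :
    InGeneralPosition H ↔ ∃ x : Fin n → G, ∀ i j, x i ∈ H j ↔ i ≠ j := by
  constructor
  · intro h
    have key : ∀ i, ∃ x : G, ∀ j, x ∈ H j ↔ i ≠ j := by
      intro i
      obtain ⟨x, hx, hx'⟩ := SetLike.exists_of_lt (h i)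
      simp only [mem_iInf, Set.mem_ofPred_eq] at hx hx'
      refine ⟨x, fun j => ⟨?_, fun hij => hx j hij.symm⟩⟩
      rintro hj rfl
      exact hx' fun k => if hk : k = i then hk ▸ hj else hx k hk
    choose x hx using key
    exact ⟨x, hx⟩
  · rintro ⟨x, hx⟩ i
    refine SetLike.lt_iff_le_and_exists.2 ⟨le_iInf₂ fun j _ => iInf_le _ j, x i, ?_, ?_⟩
    · simp only [mem_iInf, Set.mem_ofPred_eq]
      exact fun j hj => (hx i j).2 hj.symm
    · exact fun h => (hx i i).1 (mem_iInf.1 h i) rfl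

theorem exists_maximal_inGeneralPosition [Finite G] {n : ℕ} {g : Fin n → G}
    (hirr : Irredundant g) (hgen : Generates g) :
    ∃ M : Fin n → Subgroup G, (∀ i, IsCoatom (M i)) ∧ InGeneralPosition M := by
  have key : ∀ i, ∃ M : Subgroup G, IsCoatom M ∧ closure (g '' {j | j ≠ i}) ≤ M := fun i =>
    (eq_top_or_exists_le_coatom _).resolve_left fun h => hirr i (h ▸ mem_top _)
  choose M hM hle using key
  refine ⟨M, hM, inGeneralPosition_iff.2 ⟨g, fun i j => ⟨?_, ?_⟩⟩⟩
  · rintro hi rfl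
    refine (hM i).1 (top_le_iff.1 (hgen ▸ (closure_le _).2 ?_))
    rintro _ ⟨k, rfl⟩
    by_cases hk : k = i
    · exact hk ▸ hi
    · exact hle i (subset_closure ⟨k, hk, rfl⟩)
  · exact fun hij => hle j (subset_closure ⟨i, hij, rfl⟩)

end General

section Supersolvable

variable {G Q : Type*} [Group G] [Group Q]

theorem Supersolvable.of_surjective {f : G →* Q} (hf : Function.Surjective f)
    (hG : Supersolvable G) : Supersolvable Q := by
  obtain ⟨n, H, hnorm, h0, hlast, hmono, hcyc⟩ := hG
  refine ⟨n, fun i => (H i).map f, fun i => (hnorm i).map f hf, by simp [h0], ?_,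
    fun i => map_mono (hmono i), fun i => ?_⟩
  · simp only [hlast, map_top_of_surjective f hf]
  · have := (hnorm i.castSucc).subgroupOf (H i.succ)
    have := ((hnorm i.castSucc).map f hf).subgroupOf ((H i.succ).map f)
    have hi : IsCyclic (H i.succ ⧸ (H i.castSucc).subgroupOf (H i.succ)) := hcyc i
    have hle : (H i.castSucc).subgroupOf (H i.succ) ≤
        (((H i.castSucc).map f).subgroupOf ((H i.succ).map f)).comap (f.subgroupMap (H i.succ)) :=
      fun x hx => mem_map_of_mem f (mem_subgroupOf.1 hx)
    exact isCyclic_of_surjective (QuotientGroup.map _ _ (f.subgroupMap (H i.succ)) hle)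
      (QuotientGroup.map_surjective_of_surjective _ _ _
        ((QuotientGroup.mk'_surjective _).comp (f.subgroupMap_surjective _)) hle)

theorem exists_conj_eq_zpow (T : Subgroup G) [T.Normal] [IsCyclic T] (g : G) :
    ∃ m : ℤ, ∀ t ∈ T, g * t * g⁻¹ = t ^ m := by
  obtain ⟨m, hm⟩ := MonoidHom.map_cyclic (MulAut.conjNormal (H := T) g).toMonoidHom
  exact ⟨m, fun t ht => by simpa using congrArg Subtype.val (hm ⟨t, ht⟩)⟩

theorem exists_prime_normal_le_of_isCyclic [Finite G] {T : Subgroup G} [T.Normal] [IsCyclic T]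
    (hT : T ≠ ⊥) : ∃ N ≤ T, N.Normal ∧ (Nat.card N).Prime := by
  obtain ⟨p, hp, hdvd⟩ := Nat.exists_prime_and_dvd (mt T.card_eq_one.1 hT)
  have : Fact p.Prime := ⟨hp⟩
  obtain ⟨x, hx⟩ := exists_prime_orderOf_dvd_card' p hdvd
  refine ⟨zpowers (x : G), by simp, ⟨?_⟩, by simpa [Nat.card_zpowers, hx] using hp⟩
  intro y hy g
  obtain ⟨m, hm⟩ := exists_conj_eq_zpow T g
  rw [hm y ((zpowers_le.2 x.2) hy)]
  exact zpow_mem hy m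

theorem Supersolvable.exists_prime_normal_le [Finite G] (hG : Supersolvable G) {L : Subgroup G}
    [hL : L.Normal] (hne : L ≠ ⊥) : ∃ N ≤ L, N.Normal ∧ (Nat.card N).Prime := by
  obtain ⟨n, H, hnorm, h0, hlast, hmono, hcyc⟩ := hG
  by_contra hcon
  have key : ∀ i, H i ⊓ L = ⊥ := by
    intro i
    induction i using Fin.induction with
    | zero => simp [h0]
    | succ i ih =>
      by_contra hT
      have := hnorm i.succ
      have := (hnorm i.castSucc).subgroupOf (H i.succ)
      have hi : IsCyclic (H i.succ ⧸ (H i.castSucc).subgroupOf (H i.succ)) := hcyc i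
      have : IsCyclic (H i.succ ⊓ L : Subgroup G) := by
        refine isCyclic_of_injective ((QuotientGroup.mk' ((H i.castSucc).subgroupOf
          (H i.succ))).comp (inclusion (inf_le_left : H i.succ ⊓ L ≤ H i.succ))) ?_
        rw [injective_iff_map_eq_one]
        intro x hx
        have hx' : (x : G) ∈ H i.castSucc ⊓ L :=
          ⟨by simpa [QuotientGroup.eq_one_iff, mem_subgroupOf] using hx, x.2.2⟩
        rw [ih, mem_bot] at hx'
        exact Subtype.ext hx'
      obtain ⟨N, hN, hN'⟩ := exists_prime_normal_le_of_isCyclic hT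
      exact hcon ⟨N, hN.trans inf_le_right, hN'⟩
  exact hne (by simpa [hlast] using key (Fin.last n))

end Supersolvable

section Lifting

variable {G Q : Type*} [Group G] [Group Q] {f : G →* Q}

theorem closure_image_section_union {σ : Q → G} (hσ : ∀ q, f (σ q) = q) {Y : Set G}
    (hY : closure Y = f.ker) {S : Set Q} (hS : closure S = ⊤) :
    closure (σ '' S ∪ Y) = ⊤ := by
  have hker : f.ker ≤ closure (σ '' S ∪ Y) := hY ▸ closure_mono Set.subset_union_right
  rw [← comap_map_eq_self hker, eq_top_iff, ← comap_top f, ← hS]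
  refine comap_mono ((closure_le _).2 fun s hs => ?_)
  exact ⟨σ s, subset_closure (Or.inl ⟨s, hs, rfl⟩), hσ s⟩

theorem closure_image_section_union_sdiff_ne_top (hf : Function.Surjective f) {σ : Q → G}
    (hσ : ∀ q, f (σ q) = q) {Y : Set G} (hY : Y ⊆ f.ker) {S : Set Q} {t : Q}
    (ht : closure (S \ {t}) ≠ ⊤) : closure ((σ '' S ∪ Y) \ {σ t}) ≠ ⊤ := by
  intro htop
  have hle : closure ((σ '' S ∪ Y) \ {σ t}) ≤ (closure (S \ {t})).comap f := by
    rw [closure_le]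
    rintro _ ⟨⟨s, hs, rfl⟩ | hy, hne⟩
    · exact mem_comap.2 ((hσ s).symm ▸ subset_closure ⟨hs, fun h => hne (congrArg σ h)⟩)
    · exact mem_comap.2 ((MonoidHom.mem_ker.1 (hY hy)).symm ▸ one_mem _)
  rw [htop, top_le_iff, ← comap_top f] at hle
  exact ht (comap_injective hf hle)

theorem HasIndispensable.of_surjective (hf : Function.Surjective f) {k : ℕ}
    (h : HasIndispensable Q k) : HasIndispensable G k := by
  obtain ⟨S, T, hS, hTS, hT, hk⟩ := h
  obtain ⟨σ, hσ⟩ := hf.hasRightInverse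
  refine ⟨σ '' S ∪ f.ker, σ '' T, closure_image_section_union hσ (closure_eq _) hS,
    (Set.image_mono hTS).trans Set.subset_union_left, ?_, ?_⟩
  · rintro _ ⟨t, ht, rfl⟩
    exact closure_image_section_union_sdiff_ne_top hf hσ subset_rfl (hT t ht)
  · rwa [Set.ncard_image_of_injective _ hσ.injective]

theorem HasIndispensable.succ_of_surjective [Finite G] (hf : Function.Surjective f) {M : Subgroup G}
    (hM : IsCoatom M) {z : G} (hz : z ∉ M) (hker : zpowers z = f.ker) {k : ℕ}
    (h : HasIndispensable Q k) : HasIndispensable G (k + 1) := by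
  obtain ⟨S, T, hS, hTS, hT, hk⟩ := h
  have hsup : M ⊔ f.ker = ⊤ := hM.2 _ (SetLike.lt_iff_le_and_exists.2
    ⟨le_sup_left, z, mem_sup_right (hker ▸ mem_zpowers z), hz⟩)
  have hsec : ∀ q, ∃ m ∈ M, f m = q := by
    intro q
    obtain ⟨g, rfl⟩ := hf q
    obtain ⟨m, hm, n, hn, rfl⟩ := mem_sup_of_normal_right.1 (hsup ▸ mem_top g)
    exact ⟨m, hm, by simp [MonoidHom.mem_ker.1 hn]⟩
  choose σ hσM hσ using hsec
  have hcl : closure {z} = f.ker := by rw [← zpowers_eq_closure, hker]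
  have hzT : z ∉ σ '' T := by
    rintro ⟨t, -, rfl⟩
    exact hz (hσM t)
  refine ⟨σ '' S ∪ {z}, insert z (σ '' T), closure_image_section_union hσ hcl hS, ?_, ?_, ?_⟩
  · rw [Set.insert_subset_iff]
    exact ⟨Or.inr rfl, (Set.image_mono hTS).trans Set.subset_union_left⟩
  · rintro _ (rfl | ⟨t, ht, rfl⟩)
    · refine fun htop => hM.1 (top_le_iff.1 (htop ▸ (closure_le _).2 ?_))
      rintro _ ⟨⟨s, -, rfl⟩ | h, hne⟩
      exacts [hσM s, absurd h hne]
    · exact closure_image_section_union_sdiff_ne_top hf hσ (hcl ▸ subset_closure) (hT t ht)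
  · have : Finite Q := Finite.of_surjective f hf
    rw [Set.ncard_insert_of_notMem hzT,
      Set.ncard_image_of_injective _ (Function.LeftInverse.injective hσ)]
    exact Nat.succ_le_succ hk

theorem isCoatom_map_of_ker_le (hf : Function.Surjective f) {H : Subgroup G} (hH : IsCoatom H)
    (hker : f.ker ≤ H) : IsCoatom (H.map f) := by
  refine ⟨fun h => hH.1 ?_, fun K hK => ?_⟩
  · rw [← comap_map_eq_self hker, h, comap_top]
  · rw [← comap_lt_comap_of_surjective hf, comap_map_eq_self hker] at hK
    exact comap_injective hf ((hH.2 _ hK).trans (comap_top f).symm)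

end Lifting

section PrimeNormal

open scoped commutatorElement

variable {G : Type*} [Group G]

theorem commutator_le_centralizer_of_isCyclic (N : Subgroup G) [N.Normal] [IsCyclic N] :
    commutator G ≤ centralizer (N : Set G) := by
  rw [_root_.commutator_def, commutator_le]
  intro g _ h _
  obtain ⟨a, ha⟩ := exists_conj_eq_zpow N g
  obtain ⟨b, hb⟩ := exists_conj_eq_zpow N h
  rw [mem_centralizer_iff]
  have key : ∀ n ∈ N, g * h * n * (g * h)⁻¹ = h * g * n * (h * g)⁻¹ := fun n hn => by
    calc g * h * n * (g * h)⁻¹ = g * (h * n * h⁻¹) * g⁻¹ := by group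
      _ = h * (g * n * g⁻¹) * h⁻¹ := by
        rw [hb n hn, ha n hn, ha _ (zpow_mem hn b), hb _ (zpow_mem hn a), ← zpow_mul, ← zpow_mul,
          mul_comm]
      _ = h * g * n * (h * g)⁻¹ := by group
  intro n hn
  have hn' := key _ ((inferInstance : N.Normal).conj_mem' n hn (h * g))
  calc n * ⁅g, h⁆ = h * g * ((h * g)⁻¹ * n * (h * g)) * (h * g)⁻¹ * ⁅g, h⁆ := by group
    _ = g * h * ((h * g)⁻¹ * n * (h * g)) * (g * h)⁻¹ * ⁅g, h⁆ := by rw [hn']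
    _ = ⁅g, h⁆ * n := by rw [commutatorElement_def]; group

theorem zpowers_eq_of_card_prime {N : Subgroup G} (hp : (Nat.card N).Prime) {n : G} (hn : n ∈ N)
    (hn1 : n ≠ 1) : zpowers n = N := by
  have : Fact (Nat.card N).Prime := ⟨hp⟩
  refine le_antisymm (zpowers_le.2 hn) fun y hy => ?_
  obtain ⟨k, hk⟩ := mem_zpowers_of_prime_card rfl (g := (⟨n, hn⟩ : N)) (g' := ⟨y, hy⟩)
    fun h => hn1 (congrArg Subtype.val h)
  exact ⟨k, congrArg Subtype.val hk⟩

theorem eq_one_of_mem_of_card_prime {N M : Subgroup G} (hp : (Nat.card N).Prime) (hNM : ¬ N ≤ M)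
    {n : G} (hn : n ∈ N) (hnM : n ∈ M) : n = 1 := by
  by_contra hn1
  exact hNM (zpowers_eq_of_card_prime hp hn hn1 ▸ zpowers_le.2 hnM)

theorem isCoatom_or_commutator_le_inf_sup {N M L : Subgroup G} [N.Normal]
    (hp : (Nat.card N).Prime) (hM : IsCoatom M) (hL : IsCoatom L) (hNM : ¬ N ≤ M) (hNL : ¬ N ≤ L) :
    IsCoatom (M ⊓ L ⊔ N) ∨ commutator G ≤ M ⊓ L ⊔ N := by
  have hpf : Fact (Nat.card N).Prime := ⟨hp⟩
  have hcyc : IsCyclic N := isCyclic_of_prime_card rfl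
  have hdecomp : ∀ {K : Subgroup G}, IsCoatom K → ¬ N ≤ K → ∀ g, ∃ n ∈ N, ∃ k ∈ K, n * k = g :=
    fun hK hNK g => mem_sup_of_normal_left.1 ((hK.2 _ (right_lt_sup.2 hNK)).symm ▸ mem_top g)
  by_cases hC : M ⊓ centralizer (N : Set G) ≤ L
  · right
    refine (commutator_le_centralizer_of_isCyclic N).trans fun c hc => ?_
    obtain ⟨n, hn, m, hm, rfl⟩ := hdecomp hM hNM c
    have hnC : n ∈ centralizer (N : Set G) :=
      mem_centralizer_iff.2 fun n' hn' => by
        have := hcyc.isMulCommutative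
        exact congrArg Subtype.val (mul_comm' (⟨n', hn'⟩ : N) ⟨n, hn⟩)
    have hmC := (mul_mem_cancel_left hnC).1 hc
    exact mul_mem (mem_sup_right hn) (mem_sup_left ⟨hm, hC ⟨hm, hmC⟩⟩)
  · left
    obtain ⟨c, ⟨hcM, hcC⟩, hcL⟩ := SetLike.not_le_iff_exists.1 hC
    obtain ⟨n, hn, l, hl, rfl⟩ := hdecomp hL hNL c
    replace hcM : n * l ∈ M := hcM
    have hn1 : n ≠ 1 := by
      rintro rfl
      exact hcL (by simpa using hl)
    have hcomm : Commute n l := by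
      have := mem_centralizer_iff.1 hcC n hn
      rw [mul_assoc] at this
      exact mul_left_cancel this
    have hnp : n ^ Nat.card N = 1 :=
      congrArg Subtype.val (pow_card_eq_one' (x := (⟨n, hn⟩ : N)))
    have hgen : ∀ n' ∈ N, ∃ j : ℤ, n ^ j = n' := fun n' hn' =>
      mem_zpowers_iff.1 ((zpowers_eq_of_card_prime hp hn hn1).symm ▸ hn')
    have hcpD : (n * l) ^ Nat.card N ∈ M ⊓ L :=
      ⟨pow_mem hcM _, by rw [hcomm.mul_pow, hnp, one_mul]; exact pow_mem hl _⟩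
    have hMdecomp : ∀ m ∈ M, ∃ j : ℤ, ((n * l) ^ j)⁻¹ * m ∈ M ⊓ L := by
      intro m hm
      obtain ⟨n', hn', l', hl', rfl⟩ := hdecomp hL hNL m
      obtain ⟨j, rfl⟩ := hgen n' hn'
      refine ⟨j, mem_inf.2 ⟨mul_mem (inv_mem (zpow_mem hcM j)) hm, ?_⟩⟩
      have : ((n * l) ^ j)⁻¹ * (n ^ j * l') = (l ^ j)⁻¹ * l' := by
        rw [hcomm.mul_zpow, mul_inv_rev, mul_assoc, inv_mul_cancel_left]
      rw [this]
      exact mul_mem (inv_mem (zpow_mem hl j)) hl'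
    constructor
    · intro htop
      obtain ⟨d, hd, n', hn', h⟩ := mem_sup_of_normal_right.1 (htop ▸ mem_top (n * l))
      have hn'1 : n' = 1 := eq_one_of_mem_of_card_prime hp hNM hn'
        ((mul_mem_cancel_left (mem_inf.1 hd).1).1 (h ▸ hcM))
      exact hcL (by simpa [hn'1, ← h] using hd.2)
    · intro K hK
      obtain ⟨hle, k, hk, hkD⟩ := SetLike.lt_iff_le_and_exists.1 hK
      rw [sup_le_iff] at hle
      obtain ⟨n', hn', m, hm, rfl⟩ := hdecomp hM hNM k
      have hmK : m ∈ K := (mul_mem_cancel_left (hle.2 hn')).1 hk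
      obtain ⟨j, hj⟩ := hMdecomp m hm
      have hjK : (n * l) ^ j ∈ K := by
        have := mul_mem hmK (inv_mem (hle.1 hj))
        simpa using this
      have hjD : ¬ (Nat.card N : ℤ) ∣ j := by
        rintro ⟨i, rfl⟩
        refine hkD (mul_mem (mem_sup_right hn') (mem_sup_left ?_))
        refine (mul_mem_cancel_left (inv_mem ?_)).1 hj
        rw [zpow_mul, zpow_natCast]
        exact zpow_mem hcpD i
      have hcK : n * l ∈ K := by
        obtain ⟨a, b, hab⟩ := (Nat.prime_iff_prime_int.1 hp).coprime_iff_not_dvd.2 hjD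
        rw [← zpow_one (n * l), ← hab, zpow_add, mul_comm a, mul_comm b, zpow_mul, zpow_mul,
          zpow_natCast]
        exact mul_mem (zpow_mem (hle.1 hcpD) a) (zpow_mem hjK b)
      refine eq_top_iff.2 fun g _ => ?_
      obtain ⟨n'', hn'', m', hm', rfl⟩ := hdecomp hM hNM g
      obtain ⟨i, hi⟩ := hMdecomp m' hm'
      refine mul_mem (hle.2 hn'') ?_
      have := mul_mem (zpow_mem hcK i) (hle.1 hi)
      simpa using this

end PrimeNormal

section Abelian

variable {A : Type*} [CommGroup A]

theorem exists_isCoatom_notMem_of_forall_pow_ne [Finite A] {p : ℕ} (hp : p.Prime) {x : A}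
    (hx : ∀ y, y ^ p ≠ x) : ∃ M : Subgroup A, IsCoatom M ∧ x ∉ M := by
  obtain ⟨M, -, ⟨⟨hPM, hxM⟩, hmax⟩⟩ :=
    (Set.toFinite {M : Subgroup A | (powMonoidHom p).range ≤ M ∧ x ∉ M}).exists_le_maximal
      (a := (powMonoidHom p).range) ⟨le_rfl, fun ⟨y, hy⟩ => hx y hy⟩
  have hbig : ∀ L, M < L → x ∈ L := fun L hL => by
    by_contra hxL
    exact hL.not_ge (hmax ⟨hPM.trans hL.le, hxL⟩ hL.le)
  have hpow : ∀ z, z ^ p ∈ M := fun z => hPM ⟨z, rfl⟩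
  refine ⟨M, ⟨fun h => hxM (h ▸ mem_top x), fun L hL => eq_top_iff.2 fun z _ => ?_⟩, hxM⟩
  by_cases hz : z ∈ M
  · exact hL.le hz
  obtain ⟨m, hm, y, ⟨k, rfl⟩, rfl⟩ := mem_sup.1 (hbig (M ⊔ zpowers z)
    (left_lt_sup.2 fun h => hz (h (mem_zpowers z))))
  dsimp only at hbig hxM
  have hzk : z ^ k ∈ L := (mul_mem_cancel_left (hL.le hm)).1 (hbig L hL)
  have hk : ¬ (p : ℤ) ∣ k := by
    rintro ⟨i, rfl⟩
    rw [zpow_mul, zpow_natCast] at hxM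
    exact hxM (mul_mem hm (zpow_mem (hpow z) i))
  obtain ⟨a, b, hab⟩ := (Nat.prime_iff_prime_int.1 hp).coprime_iff_not_dvd.2 hk
  rw [← zpow_one z, ← hab, zpow_add, mul_comm a, mul_comm b, zpow_mul, zpow_mul, zpow_natCast]
  exact mul_mem (zpow_mem (hL.le (hpow z)) a) (zpow_mem hzk b)

theorem exists_family_through_pow {ι : Type*} {H : ι → Subgroup A} {x : ι → A}
    (hx : ∀ i j, x i ∈ H j ↔ i ≠ j) {p : ℕ} (hp : p.Prime) {y : A} {i₀ : ι}
    (hy : ∀ j, y ^ p ∈ H j ↔ i₀ ≠ j) (hy1 : (y ^ p) ^ p = 1) :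
    ∃ (H' : ι → Subgroup A) (x' : ι → A), (∀ i j, x' i ∈ H' j ↔ i ≠ j) ∧ ∀ j, y ^ p ∈ H' j := by
  classical
  have hy₀ : y ^ p ∉ H i₀ := fun h => (hy i₀).1 h rfl
  have hcop : ∀ a : ℤ, ¬ (p : ℤ) ∣ a → (y ^ p) ^ a ∉ H i₀ := by
    intro a ha hmem
    obtain ⟨c, d, hcd⟩ := (Nat.prime_iff_prime_int.1 hp).coprime_iff_not_dvd.2 ha
    refine hy₀ ?_
    rw [← zpow_one (y ^ p), ← hcd, zpow_add, mul_comm c, mul_comm d, zpow_mul, zpow_mul,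
      zpow_natCast, hy1, one_zpow, one_mul]
    exact zpow_mem hmem d
  refine ⟨fun j => if j = i₀ then zpowers (y ^ p) ⊔ H i₀ else zpowers y ⊔ H j ⊓ H i₀,
    Function.update x i₀ y, fun i j => ⟨?_, fun hij => ?_⟩, fun j => ?_⟩
  · rintro hmem rfl
    by_cases hi : i = i₀
    · subst hi
      simp only [if_true, Function.update_self] at hmem
      obtain ⟨_, ⟨a, rfl⟩, w, hw, hyw⟩ := mem_sup.1 hmem
      refine hy₀ ?_
      have : y ^ p = w ^ p := by
        conv_lhs => rw [← hyw]
        simp only [mul_pow]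
        rw [← zpow_natCast ((y ^ p) ^ a), zpow_comm, zpow_natCast, hy1, one_zpow, one_mul]
      rw [this]
      exact pow_mem hw p
    · simp only [if_neg hi, Function.update_of_ne hi] at hmem
      obtain ⟨_, ⟨a, rfl⟩, w, hw, hyw⟩ := mem_sup.1 hmem
      dsimp only at hyw
      by_cases ha : (p : ℤ) ∣ a
      · obtain ⟨b, rfl⟩ := ha
        rw [zpow_mul, zpow_natCast] at hyw
        refine (hx i i).1 ?_ rfl
        rw [← hyw]
        exact mul_mem (zpow_mem ((hy i).2 (Ne.symm hi)) b) hw.1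
      · refine hcop a ha ?_
        have : (y ^ p) ^ a = x i ^ p * (w ^ p)⁻¹ := by
          rw [← hyw, mul_pow, mul_inv_cancel_right, ← zpow_natCast, ← zpow_natCast, zpow_comm]
        rw [this]
        exact mul_mem (pow_mem ((hx i i₀).2 hi) p) (inv_mem (pow_mem hw.2 p))
  · by_cases hi : i = i₀
    · subst hi
      simpa [if_neg (Ne.symm hij)] using mem_sup_left (mem_zpowers y)
    · rw [Function.update_of_ne hi]
      by_cases hj : j = i₀
      · simpa [hj] using mem_sup_right ((hx i i₀).2 hi)
      · simpa [hj] using mem_sup_right (mem_inf.2 ⟨(hx i j).2 hij, (hx i i₀).2 hi⟩)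
  · by_cases hj : j = i₀
    · simpa [hj] using mem_sup_left (mem_zpowers (y ^ p))
    · simpa [hj] using mem_sup_left (pow_mem (mem_zpowers y) p)

end Abelian

theorem commutator_le_map {G Q : Type*} [Group G] [Group Q] {f : G →* Q}
    (hf : Function.Surjective f) {H : Subgroup G} (hH : commutator G ≤ H) :
    commutator Q ≤ H.map f := by
  rw [_root_.commutator_def, ← map_top_of_surjective f hf, ← map_commutator]
  exact map_mono hH

universe u

/-- The key estimate. The family may contain, besides maximal subgroups, arbitrary subgroups
containing the commutator subgroup, which is what makes induction on the order possible. -/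
theorem Supersolvable.hasIndispensable {G : Type u} [Group G] [Finite G] (hG : Supersolvable G)
    {ι : Type} [Finite ι] {H : ι → Subgroup G} {x : ι → G}
    (hH : ∀ i, IsCoatom (H i) ∨ commutator G ≤ H i) (hx : ∀ i j, x i ∈ H j ↔ i ≠ j) :
    HasIndispensable G (Nat.card ι) := by
  induction hn : Nat.card G using Nat.strong_induction_on generalizing G ι with
  | _ n IH =>
  subst hn
  have quot : ∀ (N : Subgroup G) [N.Normal], N ≠ ⊥ → ∀ {κ : Type} [Finite κ]
      {K : κ → Subgroup G} {y : κ → G}, (∀ i, IsCoatom (K i) ∨ commutator G ≤ K i) →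
      (∀ i j, y i ∈ K j ↔ i ≠ j) → (∀ i, N ≤ K i) → HasIndispensable (G ⧸ N) (Nat.card κ) := by
    intro N _ hN κ _ K y hK hy hle
    have hsurj := QuotientGroup.mk'_surjective N
    have hker : ∀ i, (QuotientGroup.mk' N).ker ≤ K i := by simpa using hle
    refine IH (Nat.card (G ⧸ N)) ?_ (hG.of_surjective hsurj)
      (H := fun i => (K i).map (QuotientGroup.mk' N)) (x := fun i => QuotientGroup.mk' N (y i))
      (fun i => (hK i).imp (fun h => isCoatom_map_of_ker_le hsurj h (hker i))
        (commutator_le_map hsurj)) (fun i j => ?_) rfl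
    · rw [N.card_eq_card_quotient_mul_card_subgroup]
      exact lt_mul_of_one_lt_right Nat.card_pos (N.one_lt_card_iff_ne_bot.2 hN)
    · rw [← mem_comap, comap_map_eq_self (hker j), hy]
  have card_ne : ∀ i₀ : ι, Nat.card {j // j ≠ i₀} + 1 = Nat.card ι := fun i₀ => by
    classical
    rw [← Finite.card_option, Nat.card_congr (Equiv.optionSubtypeNe i₀)]
  by_cases hcomm : commutator G = ⊥
  · rcases isEmpty_or_nonempty ι with hι | ⟨⟨i₀⟩⟩
    · exact ⟨Set.univ, ∅, closure_univ, Set.empty_subset _, by simp, by simp⟩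
    have hle : ∀ K : Subgroup G, commutator G ≤ K := fun K => hcomm ▸ bot_le
    have hnormal : ∀ K : Subgroup G, K.Normal := fun K => Normal.of_commutator_le G (hle K)
    let : CommGroup G := { ‹Group G› with
      mul_comm := fun a b => mem_center_iff.1
        ((commutator_eq_bot_iff_center_eq_top G).1 hcomm ▸ mem_top b) a }
    by_cases hbot : ⨅ i, H i = ⊥
    swap
    · have := hnormal (⨅ i, H i)
      exact (quot _ hbot hH hx fun i => iInf_le _ i).of_surjective
        (QuotientGroup.mk'_surjective _)
    have hx1 : x i₀ ≠ 1 := fun h => (hx i₀ i₀).1 (h ▸ one_mem _) rfl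
    obtain ⟨p, hp, hdvd⟩ := Nat.exists_prime_and_dvd (mt orderOf_eq_one_iff.1 hx1)
    obtain ⟨z, hz⟩ : ∃ z, z = x i₀ ^ (orderOf (x i₀) / p) := ⟨_, rfl⟩
    have hzp : orderOf z = p := hz ▸ orderOf_pow_orderOf_div (orderOf_pos _).ne' hdvd
    have hz1 : z ≠ 1 := fun h => hp.one_lt.ne' (by rw [← hzp, h, orderOf_one])
    have hzH : ∀ j, i₀ ≠ j → z ∈ H j := fun j hj => hz ▸ pow_mem ((hx i₀ j).2 hj) _
    have hz₀ : z ∉ H i₀ := fun h => hz1 <| by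
      rw [← mem_bot, ← hbot, mem_iInf]
      intro j
      by_cases hj : i₀ = j
      exacts [hj ▸ h, hzH j hj]
    have hzne : zpowers z ≠ ⊥ := mt zpowers_eq_bot.1 hz1
    have hzn := hnormal (zpowers z)
    by_cases hy : ∃ y, y ^ p = z
    · obtain ⟨y, rfl⟩ := hy
      have hyp : (y ^ p) ^ p = 1 := orderOf_dvd_iff_pow_eq_one.1 hzp.dvd
      obtain ⟨H', x', hx', hle'⟩ := exists_family_through_pow hx hp (i₀ := i₀)
        (fun j => ⟨fun h hj => hz₀ (by rwa [hj]), hzH j⟩) hyp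
      exact (quot _ hzne (fun i => Or.inr (hle _)) hx' fun i => zpowers_le.2 (hle' i)).of_surjective
        (QuotientGroup.mk'_surjective _)
    · obtain ⟨M, hM, hzM⟩ := exists_isCoatom_notMem_of_forall_pow_ne hp (not_exists.1 hy)
      rw [← card_ne i₀]
      exact (quot (κ := {j // j ≠ i₀}) (K := fun j => H j) (y := fun j => x j) _ hzne
        (fun i => hH i) (fun i j => by simp [hx, Subtype.ext_iff])
        fun i => zpowers_le.2 (hzH i i.2.symm)).succ_of_surjective
          (QuotientGroup.mk'_surjective _) hM hzM (by simp)
  · obtain ⟨N, hN, hNn, hNp⟩ := hG.exists_prime_normal_le hcomm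
    have hNbot : N ≠ ⊥ := fun h => hNp.ne_one (by simp [h])
    by_cases hall : ∀ i, N ≤ H i
    · exact (quot N hNbot hH hx hall).of_surjective (QuotientGroup.mk'_surjective _)
    obtain ⟨i₀, hi₀⟩ := not_forall.1 hall
    have hcoatom : ∀ i, ¬ N ≤ H i → IsCoatom (H i) := fun i hi =>
      (hH i).resolve_right fun h => hi (hN.trans h)
    obtain ⟨z, hzN, hz₀⟩ := SetLike.not_le_iff_exists.1 hi₀
    have hz1 : z ≠ 1 := fun h => hz₀ (h ▸ one_mem _)
    classical
    rw [← card_ne i₀]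
    refine (quot (κ := {j // j ≠ i₀}) (K := fun j => if N ≤ H j then H j else H i₀ ⊓ H j ⊔ N)
      (y := fun j => x j) N hNbot (fun i => ?_) (fun i j => ?_)
      fun i => ?_).succ_of_surjective (QuotientGroup.mk'_surjective _) (hcoatom i₀ hi₀) hz₀
        (by simpa using zpowers_eq_of_card_prime hNp hzN hz1)
    · split_ifs with h
      · exact hH i
      · exact isCoatom_or_commutator_le_inf_sup hNp (hcoatom _ hi₀) (hcoatom _ h) hi₀ h
    · have hxi : x i ∈ H i₀ := (hx i i₀).2 i.2
      split_ifs with h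
      · simp [hx, Subtype.ext_iff]
      · rw [← Subtype.coe_ne_coe, ← hx]
        refine ⟨fun hmem => ?_, fun hmem => mem_sup_left ⟨hxi, hmem⟩⟩
        obtain ⟨d, hd, n, hn, hdn⟩ := mem_sup_of_normal_right.1 hmem
        have hn1 : n = 1 := eq_one_of_mem_of_card_prime hNp hi₀ hn
          ((mul_mem_cancel_left (mem_inf.1 hd).1).1 (hdn ▸ hxi))
        rw [← hdn, hn1, mul_one]
        exact hd.2
    · split_ifs with h
      exacts [h, le_sup_right]

/-- If `G` is a finite supersolvable group, then `MaxDim(G) = m(G)`. -/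
theorem MaxDim_eq_mG_of_supersolvable
    {G : Type*} [Group G] [Finite G] (hG : Supersolvable G) :
    MaxDim G = mG G := by
  have hle : ∀ n ∈ {n | ∃ M : Fin n → Subgroup G, (∀ i, IsCoatom (M i)) ∧ InGeneralPosition M},
      n ≤ mG G := by
    rintro n ⟨M, hM, hpos⟩
    obtain ⟨x, hx⟩ := inGeneralPosition_iff.1 hpos
    simpa using (hG.hasIndispensable (fun i => Or.inl (hM i)) hx).le_mG
  refine le_antisymm (csSup_le' hle) (csSup_le' ?_)
  rintro n ⟨g, hirr, hgen⟩
  exact le_csSup ⟨_, hle⟩ (exists_maximal_inGeneralPosition hirr hgen)
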